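/- Let n ≥ 1, let E be a Köthe sequence space and let x_1,…,x_n ∈ E. Then the sequence k ↦ (|x_1(k)⋯x_n(k)|)^{1/n} belongs to E and satisfies ‖((|x_1(k)⋯x_n(k)|)^{1/n})_k‖_E^n ≤ ‖x_1‖_E⋯‖x_n‖_E; in particular, if ‖x_i‖_E ≤ 1 for all i, then this sequence lies in the closed unit ball of E. -/

import Mathlib

/-- A Köthe sequence space: a linear subspace of `ℂ^ℕ` with a complete norm such that
`ℓ₁ ⊆ E ⊆ ℓ_∞` with inclusions of norm at most 1, and which is normal. -/
structure KotheSpace : Type where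
  Mem : (ℕ → ℂ) → Prop
  nrm : (ℕ → ℂ) → ℝ
  mem_zero : Mem 0
  mem_add : ∀ {x y : ℕ → ℂ}, Mem x → Mem y → Mem (x + y)
  mem_smul : ∀ (c : ℂ) {x : ℕ → ℂ}, Mem x → Mem (c • x)
  nrm_add_le : ∀ {x y : ℕ → ℂ}, Mem x → Mem y → nrm (x + y) ≤ nrm x + nrm y
  nrm_smul : ∀ (c : ℂ) {x : ℕ → ℂ}, Mem x → nrm (c • x) = ‖c‖ * nrm x
  nrm_eq_zero_iff : ∀ {x : ℕ → ℂ}, Mem x → (nrm x = 0 ↔ x = 0)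
  l1_mem : ∀ {x : ℕ → ℂ}, Summable (fun k => ‖x k‖) → Mem x
  nrm_le_l1 : ∀ {x : ℕ → ℂ}, Summable (fun k => ‖x k‖) → nrm x ≤ ∑' k, ‖x k‖
  coord_le_nrm : ∀ {x : ℕ → ℂ}, Mem x → ∀ k, ‖x k‖ ≤ nrm x
  normal_mem : ∀ {x y : ℕ → ℂ}, Mem y → (∀ k, ‖x k‖ ≤ ‖y k‖) → Mem x
  normal_nrm : ∀ {x y : ℕ → ℂ}, Mem x → Mem y → (∀ k, ‖x k‖ ≤ ‖y k‖) → nrm x ≤ nrm y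
  complete : ∀ f : ℕ → ℕ → ℂ, (∀ i, Mem (f i)) →
    (∀ ε : ℝ, 0 < ε → ∃ N, ∀ i, N ≤ i → ∀ j, N ≤ j → nrm (f i - f j) < ε) →
    ∃ g, Mem g ∧ ∀ ε : ℝ, 0 < ε → ∃ N, ∀ i, N ≤ i → nrm (f i - g) < ε

namespace KotheSpace

/-- Membership in the Köthe dual `E^×`. -/
def dualMem (E : KotheSpace) (z : ℕ → ℂ) : Prop :=
  ∀ x, E.Mem x → Summable fun k => ‖z k * x k‖

/-- The norm of the Köthe dual `E^×`. -/
noncomputable def dualNrm (E : KotheSpace) (z : ℕ → ℂ) : ℝ :=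
  sSup {r | ∃ x, E.Mem x ∧ E.nrm x ≤ 1 ∧ r = ∑' k, ‖z k * x k‖}

/-- Membership in the Köthe bidual `E^××`. -/
def bidualMem (E : KotheSpace) (z : ℕ → ℂ) : Prop :=
  ∀ w, E.dualMem w → Summable fun k => ‖z k * w k‖

/-- The norm of the Köthe bidual `E^××`. -/
noncomputable def bidualNrm (E : KotheSpace) (z : ℕ → ℂ) : ℝ :=
  sSup {r | ∃ w, E.dualMem w ∧ E.dualNrm w ≤ 1 ∧ r = ∑' k, ‖z k * w k‖}

end KotheSpace

open scoped BigOperators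

namespace KotheSpace

variable (E : KotheSpace)

theorem nrm_nonneg {x : ℕ → ℂ} (hx : E.Mem x) : 0 ≤ E.nrm x :=
  (norm_nonneg (x 0)).trans (E.coord_le_nrm hx 0)

theorem nrm_zero : E.nrm 0 = 0 :=
  (E.nrm_eq_zero_iff E.mem_zero).2 rfl

theorem mem_norm {x : ℕ → ℂ} (hx : E.Mem x) : E.Mem fun k => ((‖x k‖ : ℝ) : ℂ) :=
  E.normal_mem hx fun k => by simp

theorem nrm_norm_le {x : ℕ → ℂ} (hx : E.Mem x) :
    E.nrm (fun k => ((‖x k‖ : ℝ) : ℂ)) ≤ E.nrm x :=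
  E.normal_nrm (E.mem_norm hx) hx fun k => by simp

theorem mem_sum {ι : Type*} (s : Finset ι) {f : ι → ℕ → ℂ} (hf : ∀ i, E.Mem (f i)) :
    E.Mem (∑ i ∈ s, f i) :=
  Finset.sum_induction f E.Mem (fun _ _ => E.mem_add) E.mem_zero fun i _ => hf i

theorem nrm_sum_le {ι : Type*} (s : Finset ι) {f : ι → ℕ → ℂ} (hf : ∀ i, E.Mem (f i)) :
    E.nrm (∑ i ∈ s, f i) ≤ ∑ i ∈ s, E.nrm (f i) := by
  classical
  induction s using Finset.induction_on with
  | empty => simp [E.nrm_zero]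
  | insert a s ha ih =>
    rw [Finset.sum_insert ha, Finset.sum_insert ha]
    exact (E.nrm_add_le (hf a) (E.mem_sum s hf)).trans (by gcongr)

/-- A nonnegative combination of the moduli of elements of `E` dominates in norm every sequence
which it dominates pointwise. -/
theorem mem_and_nrm_le_of_le_sum {ι : Type*} (s : Finset ι) {x : ι → ℕ → ℂ} {c : ι → ℝ}
    (hx : ∀ i, E.Mem (x i)) (hc : ∀ i, 0 ≤ c i) {z : ℕ → ℂ}
    (hz : ∀ k, ‖z k‖ ≤ ∑ i ∈ s, c i * ‖x i k‖) :
    E.Mem z ∧ E.nrm z ≤ ∑ i ∈ s, c i * E.nrm (x i) := by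
  have hm (i : ι) : E.Mem ((c i : ℂ) • fun k => ((‖x i k‖ : ℝ) : ℂ)) :=
    E.mem_smul _ (E.mem_norm (hx i))
  have hdom (k : ℕ) :
      ‖z k‖ ≤ ‖(∑ i ∈ s, (c i : ℂ) • fun k => ((‖x i k‖ : ℝ) : ℂ)) k‖ := by
    refine (hz k).trans ((le_abs_self _).trans (le_of_eq ?_))
    rw [← Real.norm_eq_abs, ← Complex.norm_real]
    simp [Finset.sum_apply]
  have hzm := E.normal_mem (E.mem_sum s hm) hdom
  refine ⟨hzm, (E.normal_nrm hzm (E.mem_sum s hm) hdom).trans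
    ((E.nrm_sum_le s hm).trans (Finset.sum_le_sum fun i _ => ?_))⟩
  rw [E.nrm_smul _ (E.mem_norm (hx i)), Complex.norm_real, Real.norm_of_nonneg (hc i)]
  exact mul_le_mul_of_nonneg_left (E.nrm_norm_le (hx i)) (hc i)

end KotheSpace

/-- The inequality of arithmetic and geometric means, with weights `w` to be chosen freely. -/
theorem rpow_prod_le_rpow_prod_mul_sum {n : ℕ} (hn : 1 ≤ n) {a w : Fin n → ℝ}
    (ha : ∀ i, 0 ≤ a i) (hw : ∀ i, 0 < w i) :
    (∏ i, a i) ^ ((1 : ℝ) / n) ≤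
      ∑ i, ((∏ j, w j) ^ ((1 : ℝ) / n) * (1 / n) * (w i)⁻¹) * a i := by
  have hb (i : Fin n) : 0 ≤ (w i)⁻¹ * a i := mul_nonneg (inv_nonneg.2 (hw i).le) (ha i)
  have hn0 : (n : ℝ) ≠ 0 := by positivity
  have amgm := Real.geom_mean_le_arith_mean_weighted Finset.univ (fun _ : Fin n => (1 : ℝ) / n)
    (fun i => (w i)⁻¹ * a i) (fun _ _ => by positivity) (by simp [hn0]) fun i _ => hb i
  rw [Real.finsetProd_rpow _ _ fun i _ => hb i] at amgm
  have hprod : ∏ i, a i = (∏ i, w i) * ∏ i, (w i)⁻¹ * a i := by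
    rw [← Finset.prod_mul_distrib]
    exact Finset.prod_congr rfl fun i _ => (mul_inv_cancel_left₀ (hw i).ne' _).symm
  rw [hprod, Real.mul_rpow (Finset.prod_nonneg fun i _ => (hw i).le)
    (Finset.prod_nonneg fun i _ => hb i)]
  refine (mul_le_mul_of_nonneg_left amgm
    (Real.rpow_nonneg (Finset.prod_nonneg fun i _ => (hw i).le) _)).trans_eq ?_
  simp only [Finset.mul_sum, mul_assoc]

/-- For `x_1, …, x_n ∈ E`, the sequence `k ↦ (|x_1(k)⋯x_n(k)|)^{1/n}` belongs to `E` with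
`‖·‖_E^n ≤ ‖x_1‖_E ⋯ ‖x_n‖_E`; in particular if each `‖x_i‖_E ≤ 1` then it lies in the
closed unit ball of `E`. -/
theorem geom_mean_mem (n : ℕ) (hn : 1 ≤ n) (E : KotheSpace) (x : Fin n → ℕ → ℂ)
    (hx : ∀ i, E.Mem (x i)) :
    E.Mem (fun k => Complex.ofReal ((∏ i, ‖x i k‖) ^ ((1 : ℝ) / n))) ∧
    E.nrm (fun k => Complex.ofReal ((∏ i, ‖x i k‖) ^ ((1 : ℝ) / n))) ^ n ≤ ∏ i, E.nrm (x i) ∧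
    ((∀ i, E.nrm (x i) ≤ 1) →
      E.nrm (fun k => Complex.ofReal ((∏ i, ‖x i k‖) ^ ((1 : ℝ) / n))) ≤ 1) := by
  have hn0 : (n : ℝ) ≠ 0 := by positivity
  have hN (i : Fin n) : 0 ≤ E.nrm (x i) := E.nrm_nonneg (hx i)
  have hP : 0 ≤ ∏ i, E.nrm (x i) := Finset.prod_nonneg fun i _ => hN i
  suffices h : E.Mem (fun k => Complex.ofReal ((∏ i, ‖x i k‖) ^ ((1 : ℝ) / n))) ∧
      E.nrm (fun k => Complex.ofReal ((∏ i, ‖x i k‖) ^ ((1 : ℝ) / n))) ≤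
        (∏ i, E.nrm (x i)) ^ ((1 : ℝ) / n) by
    refine ⟨h.1, ?_, fun h1 => h.2.trans
      (Real.rpow_le_one hP (Finset.prod_le_one (fun i _ => hN i) fun i _ => h1 i)
        (by positivity))⟩
    refine (pow_le_pow_left₀ (E.nrm_nonneg h.1) h.2 n).trans_eq ?_
    rw [one_div, Real.rpow_inv_natCast_pow hP (by omega)]
  by_cases hpos : ∀ i, 0 < E.nrm (x i)
  · obtain ⟨hm, hle⟩ := E.mem_and_nrm_le_of_le_sum Finset.univ
      (z := fun k => Complex.ofReal ((∏ i, ‖x i k‖) ^ ((1 : ℝ) / n)))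
      (c := fun i => (∏ j, E.nrm (x j)) ^ ((1 : ℝ) / n) * (1 / n) * (E.nrm (x i))⁻¹) hx
      (fun i => mul_nonneg (mul_nonneg (Real.rpow_nonneg hP _) (by positivity))
        (inv_nonneg.2 (hN i)))
      fun k => by
        rw [Complex.norm_real, Real.norm_of_nonneg
          (Real.rpow_nonneg (Finset.prod_nonneg fun i _ => norm_nonneg _) _)]
        exact rpow_prod_le_rpow_prod_mul_sum hn (fun i => norm_nonneg _) hpos
    refine ⟨hm, hle.trans_eq ?_⟩
    simp only [inv_mul_cancel_right₀ (hpos _).ne', Finset.sum_const, Finset.card_univ,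
      Fintype.card_fin, nsmul_eq_mul]
    field_simp
  · push Not at hpos
    obtain ⟨i, hi⟩ := hpos
    have hxi : x i = 0 := (E.nrm_eq_zero_iff (hx i)).1 (hi.antisymm (hN i))
    have hz : (fun k => Complex.ofReal ((∏ i, ‖x i k‖) ^ ((1 : ℝ) / n))) = 0 := by
      funext k
      rw [Finset.prod_eq_zero (Finset.mem_univ i) (by simp [hxi]),
        Real.zero_rpow (one_div_ne_zero hn0)]
      simp
    rw [hz, E.nrm_zero]
    exact ⟨E.mem_zero, Real.rpow_nonneg hP _⟩
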